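/- (Explicit Benjamin–Ono soliton) Let λ < 0 and x₀ ∈ ℝ, and define U(t,x) := 4λ/(1 + λ²(x − x₀ − λt)²). Then U is a solution of the Benjamin–Ono equation: ∂_t U + ∂_x [ (D U)(t,·) + U²/2 ] = 0 for all (t,x), where D acts on U(t,·) in the x variable. Equivalently, ∂_t U + 𝓗 ∂_x² U + U ∂_x U = 0, since 𝓗 ∂_x² = ∂_x D. -/

import Mathlib

open MeasureTheory

noncomputable section

/-- The Fourier transform with convention `û(ξ) = (2π)^{-1/2} ∫ u(x) e^{-ixξ} dx`. -/
def ft (u : ℝ → ℂ) (ξ : ℝ) : ℂ :=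
  (Real.sqrt (2 * Real.pi) : ℂ)⁻¹ * ∫ x : ℝ, u x * Complex.exp (-(Complex.I * x * ξ))

/-- The Fourier multiplier `D^s` with symbol `|ξ|^s`:
`(D^s u)(x) = (2π)^{-1/2} ∫ |ξ|^s û(ξ) e^{ixξ} dξ`. In particular `D = D^1 = 𝓗 ∂ₓ`,
so that the Benjamin–Ono equation `∂ₜU + 𝓗∂ₓ²U + U ∂ₓU = 0` reads
`∂ₜU + ∂ₓ[D U + U²/2] = 0`. -/
def Dop (s : ℝ) (u : ℝ → ℂ) (x : ℝ) : ℂ :=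
  (Real.sqrt (2 * Real.pi) : ℂ)⁻¹ *
    ∫ ξ : ℝ, ((|ξ| ^ s : ℝ) : ℂ) * ft u ξ * Complex.exp (Complex.I * x * ξ)

open Set Filter Topology FourierTransform

lemma integrable_of_integrableOn_Ioi_comp_neg {f : ℝ → ℂ} (hf : IntegrableOn f (Ioi 0))
    (hg : IntegrableOn (fun x => f (-x)) (Ioi 0)) : Integrable f := by
  have h : IntegrableOn f (Iio 0) := by
    have h' : IntegrableOn (fun x => f (-x)) (Ioi (-0)) := by rwa [neg_zero]
    simpa using h'.comp_neg_Iio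
  rw [← integrableOn_univ, ← Iic_union_Ioi (a := (0 : ℝ))]
  exact ((integrableOn_Iic_iff_integrableOn_Iio).2 h).union hf

lemma integral_eq_integral_Ioi_add_integral_Ioi_comp_neg {f : ℝ → ℂ}
    (hf : IntegrableOn f (Ioi 0)) (hg : IntegrableOn (fun x => f (-x)) (Ioi 0)) :
    ∫ x, f x = (∫ x in Ioi 0, f x) + ∫ x in Ioi 0, f (-x) := by
  have hi := integrable_of_integrableOn_Ioi_comp_neg hf hg
  rw [← intervalIntegral.integral_Iic_add_Ioi (b := 0) hi.integrableOn hi.integrableOn,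
    integral_comp_neg_Ioi, neg_zero, add_comm]

lemma integrableOn_mul_cexp_neg_mul_Ioi {r : ℂ} (hr : 0 < r.re) :
    IntegrableOn (fun t : ℝ => (t : ℂ) * Complex.exp (-(r * t))) (Ioi 0) := by
  have h : IntegrableOn (fun t : ℝ => t ^ ((2 : ℝ) - 1) * Real.exp (-(r.re * t))) (Ioi 0) := by
    refine .of_integral_ne_zero ?_
    rw [Real.integral_rpow_mul_exp_neg_mul_Ioi two_pos hr]
    have := Real.Gamma_pos_of_pos (two_pos (α := ℝ))
    positivity
  refine Integrable.mono' h (by fun_prop) ((ae_restrict_mem measurableSet_Ioi).mono fun t ht => ?_)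
  rw [norm_mul, Complex.norm_real, Complex.norm_exp, Real.norm_of_nonneg (le_of_lt ht)]
  norm_num

lemma integral_mul_cexp_neg_mul_Ioi {r : ℂ} (hr : 0 < r.re) :
    ∫ t : ℝ in Ioi 0, (t : ℂ) * Complex.exp (-(r * t)) = 1 / r ^ 2 := by
  have hr0 : r ≠ 0 := fun h => by simp [h] at hr
  have hderiv : ∀ t ∈ Ici (0 : ℝ), HasDerivAt
      (fun t : ℝ => -((t : ℂ) / r + 1 / r ^ 2) * Complex.exp (-(r * t)))
      ((t : ℂ) * Complex.exp (-(r * t))) t := by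
    intro t _
    have h1 : HasDerivAt (fun t : ℝ => (t : ℂ)) 1 t := Complex.ofRealCLM.hasDerivAt
    have h2 := (((h1.div_const r).add_const (1 / r ^ 2)).neg).mul ((h1.const_mul r).neg.cexp)
    refine h2.congr_deriv ?_
    simp only [Pi.neg_apply]
    field_simp
    ring
  have hlim : Tendsto (fun t : ℝ => -((t : ℂ) / r + 1 / r ^ 2) * Complex.exp (-(r * t)))
      atTop (𝓝 0) := by
    have h0 := Real.tendsto_pow_mul_exp_neg_atTop_nhds_zero 0
    have h1 := Real.tendsto_pow_mul_exp_neg_atTop_nhds_zero 1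
    have hs : Tendsto (fun t : ℝ => r.re * t) atTop atTop := tendsto_id.const_mul_atTop hr
    have e0 : Tendsto (fun t : ℝ => Complex.exp (-(r * t))) atTop (𝓝 0) := by
      rw [tendsto_zero_iff_norm_tendsto_zero]
      simpa [Complex.norm_exp, Function.comp_def] using h0.comp hs
    have e1 : Tendsto (fun t : ℝ => (t : ℂ) * Complex.exp (-(r * t))) atTop (𝓝 0) := by
      rw [tendsto_zero_iff_norm_tendsto_zero]
      have := ((h1.comp hs).const_mul (r.re)⁻¹).abs
      simp only [mul_zero, abs_zero] at this
      refine this.congr fun t => ?_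
      simp only [Function.comp_apply, pow_one, norm_mul, Complex.norm_real, Complex.norm_exp,
        ← mul_assoc, inv_mul_cancel₀ hr.ne', one_mul, abs_mul, Real.abs_exp, Real.norm_eq_abs]
      simp
    have := (e1.const_mul (-(1 / r))).add (e0.const_mul (-(1 / r ^ 2)))
    simp only [mul_zero, add_zero] at this
    exact this.congr fun t => by ring
  rw [integral_Ioi_of_hasDerivAt_of_tendsto' hderiv (integrableOn_mul_cexp_neg_mul_Ioi hr) hlim]
  simp

lemma integral_abs_mul_exp_neg_mul_abs {a : ℝ} (ha : 0 < a) (y : ℝ) :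
    ∫ ξ : ℝ, ((|ξ| : ℝ) : ℂ) * Complex.exp (-(a * (|ξ| : ℝ))) * Complex.exp (Complex.I * y * ξ) =
      1 / (a - Complex.I * y) ^ 2 + 1 / (a + Complex.I * y) ^ 2 := by
  have hm : 0 < (a - Complex.I * y : ℂ).re := by simpa using ha
  have hp : 0 < (a + Complex.I * y : ℂ).re := by simpa using ha
  have em : EqOn (fun t : ℝ => (t : ℂ) * Complex.exp (-((a - Complex.I * y) * t)))
      (fun ξ : ℝ => ((|ξ| : ℝ) : ℂ) * Complex.exp (-(a * (|ξ| : ℝ))) * Complex.exp (Complex.I * y * ξ))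
      (Ioi 0) := by
    intro t ht
    simp only [abs_of_pos (mem_Ioi.1 ht), mul_assoc, ← Complex.exp_add]
    ring_nf
  have ep : EqOn (fun t : ℝ => (t : ℂ) * Complex.exp (-((a + Complex.I * y) * t)))
      (fun ξ : ℝ => ((|-ξ| : ℝ) : ℂ) * Complex.exp (-(a * (|-ξ| : ℝ))) *
        Complex.exp (Complex.I * y * (-ξ : ℝ))) (Ioi 0) := by
    intro t ht
    simp only [abs_neg, abs_of_pos (mem_Ioi.1 ht), mul_assoc, ← Complex.exp_add]
    push_cast
    ring_nf
  rw [integral_eq_integral_Ioi_add_integral_Ioi_comp_neg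
    ((integrableOn_mul_cexp_neg_mul_Ioi hm).congr_fun em measurableSet_Ioi)
    ((integrableOn_mul_cexp_neg_mul_Ioi hp).congr_fun ep measurableSet_Ioi),
    ← setIntegral_congr_fun measurableSet_Ioi em, ← setIntegral_congr_fun measurableSet_Ioi ep,
    integral_mul_cexp_neg_mul_Ioi hm, integral_mul_cexp_neg_mul_Ioi hp]

lemma integral_cexp_neg_abs_mul_cexp (y : ℝ) :
    Integrable (fun ξ : ℝ => Complex.exp (-(|ξ| : ℝ)) * Complex.exp (Complex.I * y * ξ)) ∧
    ∫ ξ : ℝ, Complex.exp (-(|ξ| : ℝ)) * Complex.exp (Complex.I * y * ξ) =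
      2 * (1 + (y : ℂ) ^ 2)⁻¹ := by
  have hm : (-1 + Complex.I * y : ℂ).re < 0 := by simp
  have hp : (-1 - Complex.I * y : ℂ).re < 0 := by simp
  have em : EqOn (fun t : ℝ => Complex.exp ((-1 + Complex.I * y) * t))
      (fun ξ : ℝ => Complex.exp (-(|ξ| : ℝ)) * Complex.exp (Complex.I * y * ξ)) (Ioi 0) := by
    intro t ht
    simp only [abs_of_pos (mem_Ioi.1 ht), ← Complex.exp_add]
    ring_nf
  have ep : EqOn (fun t : ℝ => Complex.exp ((-1 - Complex.I * y) * t))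
      (fun ξ : ℝ => Complex.exp (-(|-ξ| : ℝ)) * Complex.exp (Complex.I * y * (-ξ : ℝ)))
      (Ioi 0) := by
    intro t ht
    simp only [abs_neg, abs_of_pos (mem_Ioi.1 ht), ← Complex.exp_add]
    push_cast
    ring_nf
  have im := (integrableOn_exp_mul_complex_Ioi hm 0).congr_fun em measurableSet_Ioi
  have ip := (integrableOn_exp_mul_complex_Ioi hp 0).congr_fun ep measurableSet_Ioi
  refine ⟨integrable_of_integrableOn_Ioi_comp_neg im ip, ?_⟩
  rw [integral_eq_integral_Ioi_add_integral_Ioi_comp_neg im ip,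
    ← setIntegral_congr_fun measurableSet_Ioi em, ← setIntegral_congr_fun measurableSet_Ioi ep,
    integral_exp_mul_complex_Ioi hm, integral_exp_mul_complex_Ioi hp]
  have h1 : (-1 + Complex.I * y : ℂ) ≠ 0 := fun h => by simp [h] at hm
  have h2 : (-1 - Complex.I * y : ℂ) ≠ 0 := fun h => by simp [h] at hp
  have h3 : (1 + (y : ℂ) ^ 2) = (-1 + Complex.I * y) * (-1 - Complex.I * y) := by
    linear_combination (y : ℂ) ^ 2 * Complex.I_sq
  rw [h3]
  simp only [Complex.ofReal_zero, mul_zero, Complex.exp_zero]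
  field_simp
  ring

lemma fourier_cexp_neg_abs (w : ℝ) :
    𝓕 (fun ξ : ℝ => Complex.exp (-(|ξ| : ℝ))) w =
      ((2 * (1 + (2 * Real.pi * w) ^ 2)⁻¹ : ℝ) : ℂ) := by
  have h := (integral_cexp_neg_abs_mul_cexp (-(2 * Real.pi * w))).2
  rw [Real.fourier_real_eq_integral_exp_smul]
  push_cast at h ⊢
  rw [neg_sq] at h
  rw [← h]
  refine integral_congr_ae (.of_forall fun ξ => ?_)
  simp only [smul_eq_mul]
  rw [mul_comm]
  ring_nf

lemma integral_inv_one_add_sq_mul_cexp (ξ : ℝ) :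
    ∫ z : ℝ, (1 + (z : ℂ) ^ 2)⁻¹ * Complex.exp (-(Complex.I * z * ξ)) =
      Real.pi * Complex.exp (-(|ξ| : ℝ)) := by
  have hf : Integrable (fun ξ : ℝ => Complex.exp (-(|ξ| : ℝ))) := by
    simpa using (integral_cexp_neg_abs_mul_cexp 0).1
  have hF : Integrable (𝓕 (fun ξ : ℝ => Complex.exp (-(|ξ| : ℝ)))) := by
    rw [funext fourier_cexp_neg_abs]
    exact ((integrable_inv_one_add_sq.comp_mul_left' (by positivity)).const_mul 2).ofReal
  have h := hf.fourierInv_fourier_eq hF (v := -ξ) (by fun_prop)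
  rw [Real.fourierInv_eq', funext fourier_cexp_neg_abs, abs_neg] at h
  have hG := Measure.integral_comp_mul_left
    (fun z : ℝ => 2 * ((1 + (z : ℂ) ^ 2)⁻¹ * Complex.exp (-(Complex.I * z * ξ)))) (2 * Real.pi)
  have hG' : (∫ v : ℝ, 2 * ((1 + ((2 * Real.pi * v : ℝ) : ℂ) ^ 2)⁻¹ *
      Complex.exp (-(Complex.I * (2 * Real.pi * v : ℝ) * ξ)))) = Complex.exp (-(|ξ| : ℝ)) := by
    rw [← h]
    refine integral_congr_ae (.of_forall fun v => ?_)
    simp only [smul_eq_mul, RCLike.inner_apply, conj_trivial]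
    push_cast
    rw [mul_comm (Complex.exp _), mul_assoc]
    ring_nf
  rw [hG', integral_const_mul,
    abs_of_pos (by positivity : (0 : ℝ) < (2 * Real.pi)⁻¹), Complex.real_smul] at hG
  rw [hG]
  generalize (∫ z : ℝ, (1 + (z : ℂ) ^ 2)⁻¹ * Complex.exp (-(Complex.I * z * ξ))) = J
  push_cast
  field_simp

lemma ft_soliton {lam : ℝ} (hlam : lam < 0) (c ξ : ℝ) :
    ft (fun z => ((4 * lam / (1 + lam ^ 2 * (z - c) ^ 2) : ℝ) : ℂ)) ξ =
      (Real.sqrt (2 * Real.pi) : ℂ)⁻¹ * (-(4 * Real.pi) *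
        (Complex.exp (-((-lam)⁻¹ * |ξ| : ℝ)) * Complex.exp (-(Complex.I * c * ξ)))) := by
  have hl : (lam : ℂ) ≠ 0 := by exact_mod_cast hlam.ne
  rw [ft]
  congr 1
  have h1 := integral_sub_right_eq_self (μ := volume) (fun z : ℝ =>
    (1 + ((-lam * z : ℝ) : ℂ) ^ 2)⁻¹ *
      Complex.exp (-(Complex.I * (-lam * z : ℝ) * ((-lam)⁻¹ * ξ : ℝ)))) c
  rw [Measure.integral_comp_mul_left (fun z : ℝ => (1 + (z : ℂ) ^ 2)⁻¹ *
      Complex.exp (-(Complex.I * z * ((-lam)⁻¹ * ξ : ℝ)))) (-lam),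
    integral_inv_one_add_sq_mul_cexp, abs_mul, abs_of_pos (inv_pos.2 (neg_pos.2 hlam)),
    Complex.real_smul] at h1
  have h2 : (∫ z : ℝ, ((4 * lam / (1 + lam ^ 2 * (z - c) ^ 2) : ℝ) : ℂ) *
      Complex.exp (-(Complex.I * z * ξ))) = 4 * lam * Complex.exp (-(Complex.I * c * ξ)) *
      ∫ z : ℝ, (1 + ((-lam * (z - c) : ℝ) : ℂ) ^ 2)⁻¹ *
      Complex.exp (-(Complex.I * (-lam * (z - c) : ℝ) * ((-lam)⁻¹ * ξ : ℝ))) := by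
    rw [← integral_const_mul]
    refine integral_congr_ae (.of_forall fun z => ?_)
    have e1 : Complex.exp (-(Complex.I * z * ξ)) = Complex.exp (-(Complex.I * c * ξ)) *
        Complex.exp (-(Complex.I * (-lam * (z - c) : ℝ) * ((-lam)⁻¹ * ξ : ℝ))) := by
      rw [← Complex.exp_add]
      congr 1
      push_cast
      field_simp
      ring
    simp only [e1]
    push_cast
    ring_nf
  rw [h2, h1]
  push_cast
  field_simp

lemma Dop_one_soliton {lam : ℝ} (hlam : lam < 0) (c y : ℝ) :
    Dop 1 (fun z => ((4 * lam / (1 + lam ^ 2 * (z - c) ^ 2) : ℝ) : ℂ)) y =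
      ((4 * lam ^ 2 * (lam ^ 2 * (y - c) ^ 2 - 1) / (1 + lam ^ 2 * (y - c) ^ 2) ^ 2 : ℝ) : ℂ) := by
  have hl : (lam : ℂ) ≠ 0 := by exact_mod_cast hlam.ne
  have ha : 0 < (-lam)⁻¹ := inv_pos.2 (neg_pos.2 hlam)
  have h1 : (∫ ξ : ℝ, ((|ξ| ^ (1 : ℝ) : ℝ) : ℂ) *
      ft (fun z => ((4 * lam / (1 + lam ^ 2 * (z - c) ^ 2) : ℝ) : ℂ)) ξ *
      Complex.exp (Complex.I * y * ξ)) =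
      (Real.sqrt (2 * Real.pi) : ℂ)⁻¹ * (-(4 * Real.pi)) *
      ∫ ξ : ℝ, ((|ξ| : ℝ) : ℂ) * Complex.exp (-(((-lam)⁻¹ : ℝ) * (|ξ| : ℝ))) *
        Complex.exp (Complex.I * (y - c : ℝ) * ξ) := by
    rw [← integral_const_mul]
    refine integral_congr_ae (.of_forall fun ξ => ?_)
    have e1 : Complex.exp (Complex.I * (y - c : ℝ) * ξ) =
        Complex.exp (-(Complex.I * c * ξ)) * Complex.exp (Complex.I * y * ξ) := by
      rw [← Complex.exp_add]
      push_cast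
      ring_nf
    simp only [ft_soliton hlam, e1, Real.rpow_one]
    push_cast
    ring
  have hpi : (Real.sqrt (2 * Real.pi) : ℂ)⁻¹ * (Real.sqrt (2 * Real.pi) : ℂ)⁻¹ *
      (-(4 * Real.pi)) = -2 := by
    rw [← mul_inv, ← Complex.ofReal_mul, Real.mul_self_sqrt (by positivity)]
    push_cast
    field_simp
    norm_num
  rw [Dop, h1, integral_abs_mul_exp_neg_mul_abs ha, ← mul_assoc, ← mul_assoc, hpi]
  have hd : (1 + lam ^ 2 * (y - c) ^ 2 : ℂ) ≠ 0 := by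
    have : 0 < 1 + lam ^ 2 * (y - c) ^ 2 := by positivity
    exact_mod_cast this.ne'
  have hfac : (1 + lam ^ 2 * (y - c) ^ 2 : ℂ) =
      (1 - Complex.I * (lam * (y - c))) * (1 + Complex.I * (lam * (y - c))) := by
    linear_combination (lam * (y - c) : ℂ) ^ 2 * Complex.I_sq
  rw [hfac] at hd
  have hd1 := left_ne_zero_of_mul hd
  have hd2 := right_ne_zero_of_mul hd
  push_cast
  rw [hfac]
  have e1 : ((-(lam : ℂ))⁻¹ - Complex.I * (y - c)) =
      -(1 + Complex.I * (lam * (y - c))) / lam := by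
    field_simp
    ring
  have e2 : ((-(lam : ℂ))⁻¹ + Complex.I * (y - c)) =
      -(1 - Complex.I * (lam * (y - c))) / lam := by
    field_simp
    ring
  rw [e1, e2, div_pow, div_pow, neg_sq, neg_sq, mul_pow]
  generalize hs : (lam * (y - c) : ℂ) = s at *
  have e3 : (lam : ℂ) ^ 2 * (y - c) ^ 2 = s ^ 2 := by rw [← hs]; ring
  rw [e3]
  field_simp
  linear_combination (-4 * s ^ 2) * Complex.I_sq

/-- explicit Benjamin–Ono soliton. The equation is stated in `ℂ` (the
imaginary part of `D U` vanishes identically for real-valued `U`). -/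
theorem stmt19 (lam x₀ : ℝ) (hlam : lam < 0) :
    ∀ t x : ℝ,
      deriv (fun τ : ℝ =>
          ((4 * lam / (1 + lam ^ 2 * (x - x₀ - lam * τ) ^ 2) : ℝ) : ℂ)) t +
        deriv (fun y : ℝ =>
          Dop 1 (fun z => ((4 * lam / (1 + lam ^ 2 * (z - x₀ - lam * t) ^ 2) : ℝ) : ℂ)) y +
            ((4 * lam / (1 + lam ^ 2 * (y - x₀ - lam * t) ^ 2) : ℝ) : ℂ) ^ 2 / 2) x = 0 := by
  intro t x
  have hflux : (fun y : ℝ =>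
      Dop 1 (fun z => ((4 * lam / (1 + lam ^ 2 * (z - x₀ - lam * t) ^ 2) : ℝ) : ℂ)) y +
        ((4 * lam / (1 + lam ^ 2 * (y - x₀ - lam * t) ^ 2) : ℝ) : ℂ) ^ 2 / 2) =
      fun y : ℝ => ((lam * (4 * lam / (1 + lam ^ 2 * (y - x₀ - lam * t) ^ 2)) : ℝ) : ℂ) := by
    funext y
    simp only [sub_sub]
    rw [Dop_one_soliton hlam]
    norm_cast
    have : 0 < 1 + lam ^ 2 * (y - (x₀ + lam * t)) ^ 2 := by positivity
    field_simp
    ring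
  have hφ : DifferentiableAt ℝ (fun s : ℝ => 4 * lam / (1 + lam ^ 2 * s ^ 2))
      (x - x₀ - lam * t) := by
    have : 1 + lam ^ 2 * (x - x₀ - lam * t) ^ 2 ≠ 0 := by positivity
    fun_prop (disch := assumption)
  have ht : HasDerivAt (fun τ : ℝ => x - x₀ - lam * τ) (-lam) t := by
    simpa using ((hasDerivAt_id t).const_mul lam).const_sub (x - x₀)
  have hx : HasDerivAt (fun y : ℝ => y - x₀ - lam * t) 1 x :=
    ((hasDerivAt_id x).sub_const x₀).sub_const (lam * t)
  have h1 := (hφ.hasDerivAt.comp t ht).ofReal_comp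
  have h2 := ((hφ.hasDerivAt.comp x hx).const_mul lam).ofReal_comp
  rw [hflux]
  refine (congrArg₂ (· + ·) h1.deriv h2.deriv).trans ?_
  push_cast
  ring

end
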